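/- arXiv:2107.03253 — 2 statements merged into one kernel-verified Lean document; each statement's English description precedes it below -/
import Mathlib

section
/- Fix Q ≥ 2, K ≥ 1 and T = 3. For every parameter θ = (β, γ, λ) with λ_1 < … < λ_{Q−1}, every initial outcome y_0 ∈ {1,…,Q}, every q_1, q_3 ∈ {1,…,Q−1}, every x = (x_1, x_2, x_3) ∈ (ℝ^K)^3, and every α ∈ ℝ, the moment function m_{y_0,q_1,1,q_3}(y, x, θ) defined casewise by: exp(x_{23}′β + γ_{y_1,1} + λ_{q_3,1}) − 1 if y_1 ≤ q_1, y_2 = 1, y_3 > q_3; −1 if y_1 ≤ q_1, y_2 > 1; exp(x_{31}′β + γ_{1,y_0} + λ_{q_1,q_3}) if y_1 > q_1, y_2 = 1, y_3 ≤ q_3; exp(x_{21}′β + γ_{y_1,y_0} + λ_{q_1,1}) if y_1 > q_1, y_2 = 1, y_3 > q_3; and 0 otherwise, satisfies Σ_{y ∈ {1,…,Q}^3} p_{y_0}(y, x, θ, α) · m_{y_0,q_1,1,q_3}(y, x, θ) = 0. -/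
open Finset

/-- The logistic CDF `Λ(u) = 1/(1+exp(-u))`. -/
noncomputable def Lam (u : ℝ) : ℝ := 1 / (1 + Real.exp (-u))

/-- Probability that an ordered logit outcome with index `ζ` and thresholds
`lam` (categories `1,…,Q`, with the conventions `λ_0 = -∞`, `λ_Q = +∞`) equals `q`. -/
noncomputable def catProb (Q : ℕ) (lam : ℕ → ℝ) (ζ : ℝ) (q : ℕ) : ℝ :=
  (if q = 1 then 1 else Lam (ζ - lam (q - 1))) - (if q = Q then 0 else Lam (ζ - lam q))

theorem cat_partial (Q : ℕ) (lam : ℕ → ℝ) (ζ : ℝ) (m : ℕ) (h1 : 1 ≤ m) (hm : m < Q) :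
    ∑ y ∈ Finset.Icc 1 m, catProb Q lam ζ y = 1 - Lam (ζ - lam m) := by
  induction m, h1 using Nat.le_induction with
  | base =>
    have : (1 : ℕ) ≠ Q := by omega
    simp [catProb, this]
  | succ n hn ih =>
    rw [Finset.sum_Icc_succ_top (by omega), ih (by omega)]
    have h1 : n + 1 ≠ Q := by omega
    have h2 : n ≠ 0 := by omega
    simp [catProb, h1, h2]

theorem cat_total (Q : ℕ) (hQ : 2 ≤ Q) (lam : ℕ → ℝ) (ζ : ℝ) :
    ∑ y ∈ Finset.Icc 1 Q, catProb Q lam ζ y = 1 := by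
  obtain ⟨n, rfl⟩ : ∃ n, Q = n + 1 := ⟨Q - 1, by omega⟩
  rw [Finset.sum_Icc_succ_top (by omega), cat_partial _ _ _ n (by omega) (by omega)]
  have h2 : n ≠ 0 := by omega
  simp [catProb, h2]

theorem cat_split (Q : ℕ) (lam : ℕ → ℝ) (ζ : ℝ) (m : ℕ) (h1 : 1 ≤ m) (hm : m < Q) (A B : ℝ) :
    ∑ y ∈ Finset.Icc 1 Q, catProb Q lam ζ y * (if y ≤ m then A else B)
      = (A + Real.exp (ζ - lam m) * B) / (1 + Real.exp (ζ - lam m)) := by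
  have hf : (Finset.Icc 1 Q).filter (fun y => y ≤ m) = Finset.Icc 1 m := by
    ext y; simp only [Finset.mem_filter, Finset.mem_Icc]; omega
  have key : ∀ y, catProb Q lam ζ y * (if y ≤ m then A else B)
      = (A - B) * (if y ≤ m then catProb Q lam ζ y else 0) + B * catProb Q lam ζ y := by
    intro y; split_ifs <;> ring
  simp_rw [key]
  rw [Finset.sum_add_distrib, ← Finset.mul_sum, ← Finset.mul_sum, ← Finset.sum_filter, hf,
    cat_partial Q lam ζ m h1 hm, cat_total Q (by omega)]
  have hp := Real.exp_pos (ζ - lam m)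
  unfold Lam
  rw [Real.exp_neg]
  field_simp
  ring

theorem statement1 (Q K : ℕ) (hQ : 2 ≤ Q) (hK : 1 ≤ K)
    (β : Fin K → ℝ) (γ lam : ℕ → ℝ)
    (hlam : ∀ q r : ℕ, 1 ≤ q → q < r → r ≤ Q - 1 → lam q < lam r)
    (y0 q1 q3 : ℕ)
    (hy0 : y0 ∈ Finset.Icc 1 Q)
    (hq1 : q1 ∈ Finset.Icc 1 (Q - 1))
    (hq3 : q3 ∈ Finset.Icc 1 (Q - 1))
    (x1 x2 x3 : Fin K → ℝ) (α : ℝ) :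
    (∑ y1 ∈ Finset.Icc 1 Q, ∑ y2 ∈ Finset.Icc 1 Q, ∑ y3 ∈ Finset.Icc 1 Q,
      (catProb Q lam ((∑ k, x1 k * β k) + γ y0 + α) y1 *
        catProb Q lam ((∑ k, x2 k * β k) + γ y1 + α) y2 *
        catProb Q lam ((∑ k, x3 k * β k) + γ y2 + α) y3) *
      (if y1 ≤ q1 ∧ y2 = 1 ∧ q3 < y3 then
          Real.exp ((∑ k, (x2 k - x3 k) * β k) + (γ y1 - γ 1) + (lam q3 - lam 1)) - 1
        else if y1 ≤ q1 ∧ 1 < y2 then -1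
        else if q1 < y1 ∧ y2 = 1 ∧ y3 ≤ q3 then
          Real.exp ((∑ k, (x3 k - x1 k) * β k) + (γ 1 - γ y0) + (lam q1 - lam q3))
        else if q1 < y1 ∧ y2 = 1 ∧ q3 < y3 then
          Real.exp ((∑ k, (x2 k - x1 k) * β k) + (γ y1 - γ y0) + (lam q1 - lam 1))
        else 0)) = 0 := by
  have hq1' : 1 ≤ q1 ∧ q1 < Q := by rw [Finset.mem_Icc] at hq1; omega
  have hq3' : 1 ≤ q3 ∧ q3 < Q := by rw [Finset.mem_Icc] at hq3; omega
  simp only [sub_mul, Finset.sum_sub_distrib]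
  generalize (∑ k, x1 k * β k) = u1
  generalize (∑ k, x2 k * β k) = u2
  generalize (∑ k, x3 k * β k) = u3
  set b := Real.exp (u1 + γ y0 + α - lam q1) with hb
  set c := Real.exp (u3 + γ 1 + α - lam q3) with hc
  have hb0 : 0 < b := Real.exp_pos _
  have hc0 : 0 < c := Real.exp_pos _
  have main : ∀ y1 ∈ Finset.Icc 1 Q, (∑ y2 ∈ Finset.Icc 1 Q, ∑ y3 ∈ Finset.Icc 1 Q,
      (catProb Q lam (u1 + γ y0 + α) y1 * catProb Q lam (u2 + γ y1 + α) y2 *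
        catProb Q lam (u3 + γ y2 + α) y3) *
      (if y1 ≤ q1 ∧ y2 = 1 ∧ q3 < y3 then
          Real.exp ((u2 - u3) + (γ y1 - γ 1) + (lam q3 - lam 1)) - 1
        else if y1 ≤ q1 ∧ 1 < y2 then -1
        else if q1 < y1 ∧ y2 = 1 ∧ y3 ≤ q3 then
          Real.exp ((u3 - u1) + (γ 1 - γ y0) + (lam q1 - lam q3))
        else if q1 < y1 ∧ y2 = 1 ∧ q3 < y3 then
          Real.exp ((u2 - u1) + (γ y1 - γ y0) + (lam q1 - lam 1))
        else 0)) = catProb Q lam (u1 + γ y0 + α) y1 *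
          (if y1 ≤ q1 then -(c / (1 + c)) else c / (1 + c) / b) := by
    intro y1 _
    set a := Real.exp (u2 + γ y1 + α - lam 1) with ha
    have ha0 : 0 < a := Real.exp_pos _
    have e1 : Real.exp ((u2 - u3) + (γ y1 - γ 1) + (lam q3 - lam 1)) = a / c := by
      rw [ha, hc, ← Real.exp_sub]; congr 1; ring
    have e2 : Real.exp ((u3 - u1) + (γ 1 - γ y0) + (lam q1 - lam q3)) = c / b := by
      rw [hb, hc, ← Real.exp_sub]; congr 1; ring
    have e3 : Real.exp ((u2 - u1) + (γ y1 - γ y0) + (lam q1 - lam 1)) = a / b := by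
      rw [ha, hb, ← Real.exp_sub]; congr 1; ring
    rw [e1, e2, e3]
    have inner : ∀ y2 ∈ Finset.Icc 1 Q, (∑ y3 ∈ Finset.Icc 1 Q,
      (catProb Q lam (u1 + γ y0 + α) y1 * catProb Q lam (u2 + γ y1 + α) y2 *
        catProb Q lam (u3 + γ y2 + α) y3) *
      (if y1 ≤ q1 ∧ y2 = 1 ∧ q3 < y3 then a / c - 1
        else if y1 ≤ q1 ∧ 1 < y2 then -1
        else if q1 < y1 ∧ y2 = 1 ∧ y3 ≤ q3 then c / b
        else if q1 < y1 ∧ y2 = 1 ∧ q3 < y3 then a / b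
        else 0)) = catProb Q lam (u1 + γ y0 + α) y1 * (catProb Q lam (u2 + γ y1 + α) y2 *
          (if y2 ≤ 1 then
            ((if y1 ≤ q1 then 0 else c / b) + c * (if y1 ≤ q1 then a / c - 1 else a / b)) / (1 + c)
            else (if y1 ≤ q1 then -1 else 0))) := by
      intro y2 hy2
      rw [Finset.mem_Icc] at hy2
      simp only [mul_assoc]
      rw [← Finset.mul_sum, ← Finset.mul_sum]
      congr 2
      by_cases h2 : y2 = 1
      · subst h2
        rw [if_pos le_rfl, hc, ← cat_split Q lam _ q3 hq3'.1 hq3'.2]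
        refine Finset.sum_congr rfl fun y3 _ => ?_
        congr 1
        by_cases h1 : y1 ≤ q1 <;> by_cases h3 : y3 ≤ q3 <;>
          simp [h1, h3, not_lt.mpr, not_le.mp, lt_of_not_ge]
      · have h2' : 1 < y2 := by omega
        rw [if_neg (by omega)]
        simp only [h2, h2', false_and, and_false, and_true, if_false]
        rw [← Finset.sum_mul, cat_total Q hQ, one_mul]
    rw [Finset.sum_congr rfl inner, ← Finset.mul_sum,
      cat_split Q lam _ 1 le_rfl (by omega), ← ha]
    congr 1
    split_ifs
    · field_simp; ring
    · field_simp; ring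
  rw [Finset.sum_congr rfl main, cat_split Q lam _ q1 hq1'.1 hq1'.2, ← hb]
  field_simp
  ring
end

section
/- Fix Q ≥ 3, K ≥ 1 and T ≥ 3. Let θ = (β, γ, λ) with λ_1 < … < λ_{Q−1}, let y_0 ∈ {1,…,Q}, x = (x_1,…,x_T) ∈ (ℝ^K)^T, and for a path y ∈ {1,…,Q}^T write z_u = z(y_{u−1}, x_u, θ) for u ∈ {1,…,T} (with y_0 the initial outcome). For q_1, q_3 ∈ {1,…,Q−1}, q_2 ∈ {2,…,Q−1}, and time indices t, s with 1 ≤ t < s ≤ T − 1, define m^{(t,s,s+1)}_{y_0,q_1,q_2,q_3}(y, x, θ) casewise by: exp(z_t − z_{s+1} + λ_{q_3,q_1})·(exp(z_{s+1} − z_s + λ_{q_2,q_3}) − 1)/(exp(λ_{q_2,q_2−1}) − 1) if y_t ≤ q_1, y_s = q_2, y_{s+1} ≤ q_3; exp(z_t − z_{s+1} + λ_{q_3,q_1})·(1 − exp(z_s − z_{s+1} + λ_{q_3,q_2}))/(1 − exp(λ_{q_2−1,q_2})) if y_t ≤ q_1, y_s = q_2, y_{s+1} > q_3; exp(z_t −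 z_{s+1} + γ_{y_s,q_2} + λ_{q_3,q_1}) if y_t ≤ q_1, y_s > q_2; −1 if y_t > q_1, y_s < q_2; −(1 − exp(z_{s+1} − z_s + λ_{q_2−1,q_3}))/(1 − exp(λ_{q_2−1,q_2})) if y_t > q_1, y_s = q_2, y_{s+1} ≤ q_3; −(exp(z_s − z_{s+1} + λ_{q_3,q_2−1}) − 1)/(exp(λ_{q_2,q_2−1}) − 1) if y_t > q_1, y_s = q_2, y_{s+1} > q_3; and 0 otherwise. Then for every weight function w : {1,…,Q}^{t−1} → ℝ and every α ∈ ℝ: Σ_{y ∈ {1,…,Q}^T} w(y_1,…,y_{t−1}) · m^{(t,s,s+1)}_{y_0,q_1,q_2,q_3}(y, x, θ) · p_{y_0}(y, x, θ, α) = 0. -/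
open Finset

/-- The full outcome path `u ↦ y_u` on `{0,1,…,T}`, with initial outcome `y_0` and
post-initial outcomes `y = (y_1,…,y_T)`. -/
def fullPath (T y0 : ℕ) (y : Fin T → ℕ) : ℕ → ℕ :=
  fun u => if h : 1 ≤ u ∧ u ≤ T then y ⟨u - 1, by omega⟩ else y0

/-- The single index `z_u = x_u′β + γ_{y_{u-1}}` for a path `p`. -/
noncomputable def zidx {K : ℕ} (β : Fin K → ℝ) (γ : ℕ → ℝ)
    (x : ℕ → Fin K → ℝ) (p : ℕ → ℕ) (u : ℕ) : ℝ :=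
  (∑ k, x u k * β k) + γ (p (u - 1))

/-- Model probability `p_{y_0}(y, x, θ, α)` of a full outcome path `p : ℕ → ℕ`
(with `p 0` the initial outcome). -/
noncomputable def pathProb (Q T : ℕ) {K : ℕ} (β : Fin K → ℝ) (γ lam : ℕ → ℝ)
    (x : ℕ → Fin K → ℝ) (α : ℝ) (p : ℕ → ℕ) : ℝ :=
  ∏ u ∈ Finset.Icc 1 T, catProb Q lam (zidx β γ x p u + α) (p u)


lemma catSum_lt (Q : ℕ) (lam : ℕ → ℝ) (ζ : ℝ) (n : ℕ) (h1 : 1 ≤ n) (h2 : n < Q) :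
    ∑ c ∈ Icc 1 n, catProb Q lam ζ c = 1 - Lam (ζ - lam n) := by
  induction n, h1 using Nat.le_induction with
  | base => simp [catProb]; omega
  | succ n hn ih =>
    rw [Finset.sum_Icc_succ_top (by omega), ih (by omega)]
    have e1 : n + 1 ≠ 1 := by omega
    have e2 : n + 1 ≠ Q := by omega
    simp only [catProb, if_neg e1, if_neg e2, Nat.add_sub_cancel]
    ring

lemma catSum (Q : ℕ) (hQ : 3 ≤ Q) (lam : ℕ → ℝ) (ζ : ℝ) :
    ∑ c ∈ Icc 1 Q, catProb Q lam ζ c = 1 := by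
  obtain ⟨n, rfl⟩ : ∃ n, Q = n + 1 := ⟨Q - 1, by omega⟩
  rw [Finset.sum_Icc_succ_top (by omega), catSum_lt _ _ _ n (by omega) (by omega)]
  have e1 : n + 1 ≠ 1 := by omega
  simp only [catProb, if_neg e1, Nat.add_sub_cancel]
  simp

lemma catStep (Q : ℕ) (hQ : 3 ≤ Q) (lam : ℕ → ℝ) (ζ : ℝ) (n : ℕ) (h1 : 1 ≤ n) (h2 : n < Q)
    (A B : ℝ) :
    ∑ c ∈ Icc 1 Q, (if c ≤ n then A else B) * catProb Q lam ζ c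
      = A * (1 - Lam (ζ - lam n)) + B * Lam (ζ - lam n) := by
  have e : ∀ c, (if c ≤ n then A else B) * catProb Q lam ζ c
      = B * catProb Q lam ζ c + (A - B) * (if c ≤ n then catProb Q lam ζ c else 0) := by
    intro c; split_ifs <;> ring
  simp_rw [e]
  rw [Finset.sum_add_distrib, ← Finset.mul_sum, ← Finset.mul_sum, catSum Q hQ,
    ← Finset.sum_filter]
  have e2 : (Icc 1 Q).filter (fun c => c ≤ n) = Icc 1 n := by
    ext c; simp; omega
  rw [e2, catSum_lt Q lam ζ n h1 h2]
  ring

lemma catStep3 (Q : ℕ) (hQ : 3 ≤ Q) (lam : ℕ → ℝ) (ζ : ℝ) (n : ℕ) (h1 : 2 ≤ n) (h2 : n < Q)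
    (A B C : ℝ) :
    ∑ c ∈ Icc 1 Q, (if c < n then A else if c = n then B else C) * catProb Q lam ζ c
      = A * (1 - Lam (ζ - lam (n - 1))) + B * (Lam (ζ - lam (n - 1)) - Lam (ζ - lam n))
        + C * Lam (ζ - lam n) := by
  have e : ∀ c, (if c < n then A else if c = n then B else C) * catProb Q lam ζ c
      = (if c ≤ n - 1 then A - B else 0) * catProb Q lam ζ c
        + (if c ≤ n then B else C) * catProb Q lam ζ c := by
    intro c; split_ifs <;> first | omega | ring
  simp_rw [e]
  rw [Finset.sum_add_distrib, catStep Q hQ _ _ _ (by omega) (by omega),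
    catStep Q hQ _ _ _ (by omega) (by omega)]
  ring

/-- moment function in terms of the relevant coordinates -/
noncomputable def MM (γ lam : ℕ → ℝ) (q1 q2 q3 a c d : ℕ) (zt zs z1 : ℝ) : ℝ :=
  if a ≤ q1 ∧ c = q2 ∧ d ≤ q3 then
          Real.exp (zt - z1 + (lam q3 - lam q1)) *
            ((Real.exp (z1 - zs + (lam q2 - lam q3)) - 1) /
              (Real.exp (lam q2 - lam (q2 - 1)) - 1))
        else if a ≤ q1 ∧ c = q2 ∧ q3 < d then
          Real.exp (zt - z1 + (lam q3 - lam q1)) *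
            ((1 - Real.exp (zs - z1 + (lam q3 - lam q2))) /
              (1 - Real.exp (lam (q2 - 1) - lam q2)))
        else if a ≤ q1 ∧ q2 < c then
          Real.exp (zt - z1 + (γ c - γ q2) + (lam q3 - lam q1))
        else if q1 < a ∧ c < q2 then -1
        else if q1 < a ∧ c = q2 ∧ d ≤ q3 then
          -((1 - Real.exp (z1 - zs + (lam (q2 - 1) - lam q3))) /
              (1 - Real.exp (lam (q2 - 1) - lam q2)))
        else if q1 < a ∧ c = q2 ∧ q3 < d then
          -((Real.exp (zs - z1 + (lam q3 - lam (q2 - 1))) - 1) /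
              (Real.exp (lam q2 - lam (q2 - 1)) - 1))
        else 0

lemma Lam_eq (u v : ℝ) : Lam (u - v) = Real.exp u / (Real.exp u + Real.exp v) := by
  unfold Lam
  rw [neg_sub, Real.exp_sub]
  have := Real.exp_pos u
  have := Real.exp_pos v
  field_simp

lemma alg1 (zs Z α l2 l1 l3 : ℝ) (h : l1 < l2) :
    (((Real.exp (Z - zs + (l2 - l3)) - 1) / (Real.exp (l2 - l1) - 1)) * (1 - Lam (Z + α - l3))
      + ((1 - Real.exp (zs - Z + (l3 - l2))) / (1 - Real.exp (l1 - l2))) * Lam (Z + α - l3))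
      * (Lam (zs + α - l1) - Lam (zs + α - l2)) + Lam (zs + α - l2) = Lam (Z + α - l3) := by
  simp only [Lam_eq, Real.exp_add, Real.exp_sub]
  have h' := Real.exp_lt_exp.2 h
  have p1 := Real.exp_pos zs
  have p2 := Real.exp_pos Z
  have p3 := Real.exp_pos α
  have p4 := Real.exp_pos l1
  have p5 := Real.exp_pos l2
  have p6 := Real.exp_pos l3
  generalize Real.exp zs = a at *
  generalize Real.exp Z = b at *
  generalize Real.exp α = e at *
  generalize Real.exp l1 = k at *
  generalize Real.exp l2 = l at *
  generalize Real.exp l3 = c at *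
  have n1 : l - k ≠ 0 := by linarith
  have e1 : l / k - 1 = (l - k) / k := by field_simp
  have e2 : 1 - k / l = (l - k) / l := by field_simp
  rw [e1, e2]
  field_simp
  ring

lemma alg2 (zs Z α l2 l1 l3 : ℝ) (h : l1 < l2) :
    (1 - Lam (zs + α - l1)) +
    (((1 - Real.exp (Z - zs + (l1 - l3))) / (1 - Real.exp (l1 - l2))) * (1 - Lam (Z + α - l3))
      + ((Real.exp (zs - Z + (l3 - l1)) - 1) / (Real.exp (l2 - l1) - 1)) * Lam (Z + α - l3))
      * (Lam (zs + α - l1) - Lam (zs + α - l2)) = 1 - Lam (Z + α - l3) := by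
  simp only [Lam_eq, Real.exp_add, Real.exp_sub]
  have h' := Real.exp_lt_exp.2 h
  have p1 := Real.exp_pos zs
  have p2 := Real.exp_pos Z
  have p3 := Real.exp_pos α
  have p4 := Real.exp_pos l1
  have p5 := Real.exp_pos l2
  have p6 := Real.exp_pos l3
  generalize Real.exp zs = a at *
  generalize Real.exp Z = b at *
  generalize Real.exp α = e at *
  generalize Real.exp l1 = k at *
  generalize Real.exp l2 = l at *
  generalize Real.exp l3 = c at *
  have n1 : l - k ≠ 0 := by linarith
  have e1 : l / k - 1 = (l - k) / k := by field_simp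
  have e2 : 1 - k / l = (l - k) / l := by field_simp
  rw [e1, e2]
  field_simp
  ring

lemma alg3 (zt Z α l1 l3 : ℝ) :
    Real.exp (zt - Z + (l3 - l1)) * Lam (Z + α - l3) * (1 - Lam (zt + α - l1))
      + -(1 - Lam (Z + α - l3)) * Lam (zt + α - l1) = 0 := by
  simp only [Lam_eq, Real.exp_add, Real.exp_sub]
  have p1 := Real.exp_pos zt
  have p2 := Real.exp_pos Z
  have p3 := Real.exp_pos α
  have p4 := Real.exp_pos l1
  have p6 := Real.exp_pos l3
  field_simp
  ring

lemma core (Q : ℕ) (hQ : 3 ≤ Q) (γ lam : ℕ → ℝ) (q1 q2 q3 : ℕ) (h2 : 2 ≤ q2) (h2' : q2 < Q)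
    (h3 : 1 ≤ q3) (h3' : q3 < Q) (hl : lam (q2 - 1) < lam q2) (a : ℕ) (zt zs X α : ℝ) :
    ∑ c ∈ Icc 1 Q, (∑ d ∈ Icc 1 Q, MM γ lam q1 q2 q3 a c d zt zs (X + γ c)
        * catProb Q lam (X + γ c + α) d) * catProb Q lam (zs + α) c
    = if a ≤ q1 then Real.exp (zt - (X + γ q2) + (lam q3 - lam q1)) * Lam (X + γ q2 + α - lam q3)
      else -(1 - Lam (X + γ q2 + α - lam q3)) := by
  by_cases ha : a ≤ q1
  · have ha' : ¬ q1 < a := by omega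
    have key : ∀ c, (∑ d ∈ Icc 1 Q, MM γ lam q1 q2 q3 a c d zt zs (X + γ c)
        * catProb Q lam (X + γ c + α) d) =
        if c < q2 then 0 else if c = q2 then
          Real.exp (zt - (X + γ q2) + (lam q3 - lam q1)) *
            ((Real.exp ((X + γ q2) - zs + (lam q2 - lam q3)) - 1) /
              (Real.exp (lam q2 - lam (q2 - 1)) - 1)) * (1 - Lam (X + γ q2 + α - lam q3)) +
          Real.exp (zt - (X + γ q2) + (lam q3 - lam q1)) *
            ((1 - Real.exp (zs - (X + γ q2) + (lam q3 - lam q2))) /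
              (1 - Real.exp (lam (q2 - 1) - lam q2))) * Lam (X + γ q2 + α - lam q3)
        else Real.exp (zt - (X + γ q2) + (lam q3 - lam q1)) := by
      intro c
      rcases lt_trichotomy c q2 with h | h | h
      · have : c ≠ q2 := by omega
        have : ¬ q2 < c := by omega
        simp [MM, *]
      · subst h
        rw [if_neg (lt_irrefl _), if_pos rfl, ← catStep Q hQ _ _ _ h3 h3']
        refine Finset.sum_congr rfl fun d _ => ?_
        by_cases hd : d ≤ q3
        · simp [MM, ha, hd]
        · have : q3 < d := by omega
          simp [MM, ha, hd, this]
      · have e1 : c ≠ q2 := by omega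
        have e2 : ¬ c < q2 := by omega
        have e3 : zt - (X + γ c) + (γ c - γ q2) + (lam q3 - lam q1)
          = zt - (X + γ q2) + (lam q3 - lam q1) := by ring
        simp only [MM, ha, e1, e2, h, e3, true_and, false_and, if_true, if_false]
        rw [← Finset.mul_sum, catSum Q hQ, mul_one]
    simp_rw [key]
    rw [catStep3 Q hQ _ _ _ h2 h2', if_pos ha]
    linear_combination Real.exp (zt - (X + γ q2) + (lam q3 - lam q1)) *
      alg1 zs (X + γ q2) α _ _ (lam q3) hl
  · have ha' : q1 < a := by omega
    have key : ∀ c, (∑ d ∈ Icc 1 Q, MM γ lam q1 q2 q3 a c d zt zs (X + γ c)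
        * catProb Q lam (X + γ c + α) d) =
        if c < q2 then -1 else if c = q2 then
          -((1 - Real.exp ((X + γ q2) - zs + (lam (q2 - 1) - lam q3))) /
              (1 - Real.exp (lam (q2 - 1) - lam q2))) * (1 - Lam (X + γ q2 + α - lam q3)) +
          -((Real.exp (zs - (X + γ q2) + (lam q3 - lam (q2 - 1))) - 1) /
              (Real.exp (lam q2 - lam (q2 - 1)) - 1)) * Lam (X + γ q2 + α - lam q3)
        else 0 := by
      intro c
      rcases lt_trichotomy c q2 with h | h | h
      · have e1 : c ≠ q2 := by omega
        simp only [MM, ha, ha', e1, h, true_and, false_and, if_true, if_false]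
        rw [← Finset.mul_sum, catSum Q hQ, mul_one]
      · subst h
        rw [if_neg (lt_irrefl _), if_pos rfl, ← catStep Q hQ _ _ _ h3 h3']
        refine Finset.sum_congr rfl fun d _ => ?_
        by_cases hd : d ≤ q3
        · simp [MM, ha, ha', hd]
        · have : q3 < d := by omega
          simp [MM, ha, ha', hd, this]
      · have e1 : c ≠ q2 := by omega
        have e2 : ¬ c < q2 := by omega
        simp [MM, ha, e1, e2]
    simp_rw [key]
    rw [catStep3 Q hQ _ _ _ h2 h2', if_neg ha]
    linear_combination -alg2 zs (X + γ q2) α _ _ (lam q3) hl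

/-- model expectation of a function of the path, horizon `T` -/
noncomputable def EE (Q T : ℕ) {K : ℕ} (β : Fin K → ℝ) (γ lam : ℕ → ℝ)
    (x : ℕ → Fin K → ℝ) (α : ℝ) (y0 : ℕ) (f : (ℕ → ℕ) → ℝ) : ℝ :=
  ∑ y ∈ Fintype.piFinset (fun _ : Fin T => Finset.Icc 1 Q),
    f (fullPath T y0 y) * pathProb Q T β γ lam x α (fullPath T y0 y)

lemma fullPath_snoc (T y0 : ℕ) (y : Fin T → ℕ) (c : ℕ) :
    fullPath (T + 1) y0 (Fin.snoc (α := fun _ => ℕ) y c)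
      = Function.update (fullPath T y0 y) (T + 1) c := by
  funext u
  by_cases hu : u = T + 1
  · subst hu
    simp [fullPath, Fin.snoc]
  · rw [Function.update_of_ne hu]
    unfold fullPath
    by_cases h : 1 ≤ u ∧ u ≤ T
    · have h' : 1 ≤ u ∧ u ≤ T + 1 := by omega
      have h'' : u - 1 < T := by omega
      simp [h, h', Fin.snoc, h'']
    · have h' : ¬ (1 ≤ u ∧ u ≤ T + 1) := by omega
      rw [dif_neg h, dif_neg h']

lemma pathProb_update (Q T : ℕ) {K : ℕ} (β : Fin K → ℝ) (γ lam : ℕ → ℝ)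
    (x : ℕ → Fin K → ℝ) (α : ℝ) (p : ℕ → ℕ) (c : ℕ) :
    pathProb Q (T + 1) β γ lam x α (Function.update p (T + 1) c)
      = pathProb Q T β γ lam x α p * catProb Q lam (zidx β γ x p (T + 1) + α) c := by
  unfold pathProb
  rw [Finset.prod_Icc_succ_top (by omega)]
  congr 1
  · refine Finset.prod_congr rfl fun u hu => ?_
    rw [Finset.mem_Icc] at hu
    have e1 : u ≠ T + 1 := by omega
    have e2 : u - 1 ≠ T + 1 := by omega
    simp [zidx, e1, e2]
  · simp [zidx]

lemma EE_succ (Q T : ℕ) {K : ℕ} (β : Fin K → ℝ) (γ lam : ℕ → ℝ)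
    (x : ℕ → Fin K → ℝ) (α : ℝ) (y0 : ℕ) (f : (ℕ → ℕ) → ℝ) :
    EE Q (T + 1) β γ lam x α y0 f = EE Q T β γ lam x α y0 (fun p =>
      ∑ c ∈ Icc 1 Q, f (Function.update p (T + 1) c)
        * catProb Q lam (zidx β γ x p (T + 1) + α) c) := by
  unfold EE
  simp_rw [Finset.sum_mul]
  rw [← Finset.sum_product']
  symm
  refine Finset.sum_bij' (fun a _ => Fin.snoc (α := fun _ => ℕ) a.1 a.2)
    (fun y _ => (Fin.init (α := fun _ => ℕ) y, y (Fin.last T))) ?_ ?_ ?_ ?_ ?_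
  · rintro ⟨y, c⟩ h
    simp only [Finset.mem_product, Fintype.mem_piFinset] at h ⊢
    intro i
    refine Fin.lastCases ?_ (fun i => ?_) i
    · simpa using h.2
    · simpa using h.1 i
  · intro y h
    simp only [Finset.mem_product, Fintype.mem_piFinset] at h ⊢
    exact ⟨fun i => h _, h _⟩
  · rintro ⟨y, c⟩ h
    simp
  · intro y h
    simp
  · rintro ⟨y, c⟩ h
    simp only
    rw [fullPath_snoc, pathProb_update]
    ring

lemma EE_reduce (Q : ℕ) (hQ : 3 ≤ Q) (n T : ℕ) (hn : n ≤ T) {K : ℕ} (β : Fin K → ℝ)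
    (γ lam : ℕ → ℝ) (x : ℕ → Fin K → ℝ) (α : ℝ) (y0 : ℕ) (f : (ℕ → ℕ) → ℝ)
    (hf : ∀ p m c, n < m → f (Function.update p m c) = f p) :
    EE Q T β γ lam x α y0 f = EE Q n β γ lam x α y0 f := by
  induction T, hn using Nat.le_induction with
  | base => rfl
  | succ T hT ih =>
    rw [EE_succ, ← ih]
    congr 1
    funext p
    simp_rw [hf p (T + 1) _ (by omega)]
    rw [← Finset.mul_sum, catSum Q hQ, mul_one]

theorem statement3 (Q K T : ℕ) (hQ : 3 ≤ Q) (hK : 1 ≤ K) (hT : 3 ≤ T)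
    (β : Fin K → ℝ) (γ lam : ℕ → ℝ)
    (hlam : ∀ q r : ℕ, 1 ≤ q → q < r → r ≤ Q - 1 → lam q < lam r)
    (y0 : ℕ) (hy0 : y0 ∈ Finset.Icc 1 Q)
    (q1 q3 : ℕ) (hq1 : q1 ∈ Finset.Icc 1 (Q - 1)) (hq3 : q3 ∈ Finset.Icc 1 (Q - 1))
    (q2 : ℕ) (hq2 : q2 ∈ Finset.Icc 2 (Q - 1))
    (t s : ℕ) (ht : 1 ≤ t) (hts : t < s) (hs : s ≤ T - 1)
    (x : ℕ → Fin K → ℝ) (w : (Fin (t - 1) → ℕ) → ℝ) (α : ℝ) :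
    (∑ y ∈ Fintype.piFinset (fun _ : Fin T => Finset.Icc 1 Q),
      w (fun i => fullPath T y0 y (i.val + 1)) *
      (let p := fullPath T y0 y
       let z := zidx β γ x p
       if p t ≤ q1 ∧ p s = q2 ∧ p (s + 1) ≤ q3 then
          Real.exp (z t - z (s + 1) + (lam q3 - lam q1)) *
            ((Real.exp (z (s + 1) - z s + (lam q2 - lam q3)) - 1) /
              (Real.exp (lam q2 - lam (q2 - 1)) - 1))
        else if p t ≤ q1 ∧ p s = q2 ∧ q3 < p (s + 1) then
          Real.exp (z t - z (s + 1) + (lam q3 - lam q1)) *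
            ((1 - Real.exp (z s - z (s + 1) + (lam q3 - lam q2))) /
              (1 - Real.exp (lam (q2 - 1) - lam q2)))
        else if p t ≤ q1 ∧ q2 < p s then
          Real.exp (z t - z (s + 1) + (γ (p s) - γ q2) + (lam q3 - lam q1))
        else if q1 < p t ∧ p s < q2 then -1
        else if q1 < p t ∧ p s = q2 ∧ p (s + 1) ≤ q3 then
          -((1 - Real.exp (z (s + 1) - z s + (lam (q2 - 1) - lam q3))) /
              (1 - Real.exp (lam (q2 - 1) - lam q2)))
        else if q1 < p t ∧ p s = q2 ∧ q3 < p (s + 1) then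
          -((Real.exp (z s - z (s + 1) + (lam q3 - lam (q2 - 1))) - 1) /
              (Real.exp (lam q2 - lam (q2 - 1)) - 1))
        else 0) *
      pathProb Q T β γ lam x α (fullPath T y0 y)) = 0 := by
  rw [Finset.mem_Icc] at hq1 hq2 hq3
  have hl : lam (q2 - 1) < lam q2 := hlam _ _ (by omega) (by omega) (by omega)
  set W : (ℕ → ℕ) → ℝ := fun p => w (fun i => p (i.val + 1)) with hW
  have hWu : ∀ p m c, t ≤ m → W (Function.update p m c) = W p := by
    intro p m c hm
    simp only [hW]
    congr 1
    funext i
    exact Function.update_of_ne (by omega) _ _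
  have hzu : ∀ p m c u, u ≤ m → 1 ≤ m →
      zidx β γ x (Function.update p m c) u = zidx β γ x p u := by
    intro p m c u hm hm'
    unfold zidx
    rw [Function.update_of_ne (by omega)]
  change EE Q T β γ lam x α y0 (fun p => W p * MM γ lam q1 q2 q3 (p t) (p s) (p (s + 1))
    (zidx β γ x p t) (zidx β γ x p s) (zidx β γ x p (s + 1))) = 0
  rw [EE_reduce Q hQ (s + 1) T (by omega)]
  swap
  · intro p m c hm
    rw [hWu _ _ _ (by omega), hzu _ _ _ _ (by omega) (by omega), hzu _ _ _ _ (by omega) (by omega),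
      hzu _ _ _ _ (by omega) (by omega), Function.update_of_ne (by omega),
      Function.update_of_ne (by omega), Function.update_of_ne (by omega)]
  obtain ⟨r, rfl⟩ : ∃ r, s = r + 1 := ⟨s - 1, by omega⟩
  rw [EE_succ, EE_succ]
  set X : ℝ := ∑ k, x (r + 1 + 1) k * β k with hX
  have hG : ∀ p : ℕ → ℕ, (∑ c ∈ Icc 1 Q, (∑ d ∈ Icc 1 Q,
      (fun p => W p * MM γ lam q1 q2 q3 (p t) (p (r + 1)) (p (r + 1 + 1))
        (zidx β γ x p t) (zidx β γ x p (r + 1)) (zidx β γ x p (r + 1 + 1)))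
        (Function.update (Function.update p (r + 1) c) (r + 1 + 1) d)
        * catProb Q lam (zidx β γ x (Function.update p (r + 1) c) (r + 1 + 1) + α) d)
        * catProb Q lam (zidx β γ x p (r + 1) + α) c)
      = W p * (if p t ≤ q1 then
          Real.exp (zidx β γ x p t - (X + γ q2) + (lam q3 - lam q1))
            * Lam (X + γ q2 + α - lam q3)
        else -(1 - Lam (X + γ q2 + α - lam q3))) := by
    intro p
    rw [← core Q hQ γ lam q1 q2 q3 (by omega) (by omega) (by omega) (by omega) hl (p t)
      (zidx β γ x p t) (zidx β γ x p (r + 1)) X α, Finset.mul_sum]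
    refine Finset.sum_congr rfl fun c _ => ?_
    rw [← mul_assoc, Finset.mul_sum]
    congr 1
    refine Finset.sum_congr rfl fun d _ => ?_
    have e : zidx β γ x (Function.update p (r + 1) c) (r + 1 + 1) = X + γ c := by
      simp [zidx, hX]
    simp only
    rw [hWu _ _ _ (by omega), hWu _ _ _ (by omega),
      hzu _ _ _ t (by omega) (by omega), hzu _ _ _ t (by omega) (by omega),
      hzu _ _ _ (r + 1) (by omega) (by omega), hzu _ _ _ (r + 1) (by omega) (by omega),
      hzu _ _ _ (r + 1 + 1) (by omega) (by omega), e, Function.update_self,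
      Function.update_of_ne (by omega : t ≠ r + 1 + 1),
      Function.update_of_ne (by omega : t ≠ r + 1),
      Function.update_of_ne (by omega : r + 1 ≠ r + 1 + 1), Function.update_self, mul_assoc]
  rw [show (fun p : ℕ → ℕ => _) = _ from funext hG]
  rw [EE_reduce Q hQ t r (by omega)]
  swap
  · intro p m c hm
    rw [hWu _ _ _ (by omega), hzu _ _ _ _ (by omega) (by omega),
      Function.update_of_ne (by omega)]
  obtain ⟨v, rfl⟩ : ∃ v, t = v + 1 := ⟨t - 1, by omega⟩
  rw [EE_succ]
  unfold EE
  refine Finset.sum_eq_zero fun y _ => ?_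
  refine mul_eq_zero_of_left ?_ _
  simp_rw [hWu _ (v + 1) _ le_rfl, hzu _ (v + 1) _ (v + 1) le_rfl (by omega),
    Function.update_self, mul_assoc]
  rw [← Finset.mul_sum, catStep Q hQ _ _ _ (by omega) (by omega), alg3, mul_zero]
end
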